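/- Let G = (V, E) be a finite simple graph with no isolated vertices, and let G' be the split graph with vertex set V_1 ∪ V_2, where V_1 = {v^1 : v ∈ V} and V_2 = {v^2 : v ∈ V} are disjoint copies of V, V_1 is a stable set in G', V_2 induces a complete graph in G', and v^1 is adjacent to u^2 in G' if and only if v is adjacent to u in G. Then γ_gr^t(G') = 2·γ_gr^t(G). -/

import Mathlib

/-- `s` is a legal (open neighborhood) sequence in `G`. -/
def IsLegalSeq {V : Type*} (G : SimpleGraph V) (s : List V) : Prop :=
  s.Nodup ∧ ∀ i : Fin s.length, ∃ w : V, G.Adj (s.get i) w ∧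
    ∀ j : Fin s.length, (j : ℕ) < (i : ℕ) → ¬ G.Adj (s.get j) w

/-- The Grundy total domination number: the maximum length of a legal sequence. -/
noncomputable def grundyTotal {V : Type*} (G : SimpleGraph V) : ℕ :=
  sSup {n | ∃ s : List V, IsLegalSeq G s ∧ s.length = n}

/-- The split graph associated to `G`: its vertex set consists of two disjoint copies of
`V`, the first copy (`Sum.inl`) is a stable set, the second copy (`Sum.inr`) induces a
complete graph, and `inl v` is adjacent to `inr u` if and only if `v` is adjacent to `u`
in `G`. -/
def splitGraphOf {V : Type*} (G : SimpleGraph V) : SimpleGraph (V ⊕ V) :=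
  SimpleGraph.fromRel (fun x y =>
    match x, y with
    | .inl v, .inr u => G.Adj v u
    | .inr _, .inr _ => True
    | _, _ => False)

theorem isLegalSeq_nil {V : Type*} (G : SimpleGraph V) : IsLegalSeq G [] :=
  ⟨List.nodup_nil, fun i => i.elim0⟩

theorem isLegalSeq_append_singleton {V : Type*} {G : SimpleGraph V} {s : List V} {a : V} :
    IsLegalSeq G (s ++ [a]) ↔
      IsLegalSeq G s ∧ ∃ w, G.Adj a w ∧ ∀ b ∈ s, ¬ G.Adj b w := by
  constructor
  · rintro ⟨hnd, h⟩
    refine ⟨⟨hnd.of_append_left, fun i => ?_⟩, ?_⟩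
    · obtain ⟨w, hw, hj⟩ := h ⟨i, by have := i.2; grind⟩
      refine ⟨w, by simpa [List.getElem_append_left i.2] using hw, fun j hji => ?_⟩
      simpa [List.getElem_append_left j.2] using hj ⟨j, by have := j.2; grind⟩ hji
    · obtain ⟨w, hw, hj⟩ := h ⟨s.length, by simp⟩
      refine ⟨w, by simpa using hw, fun b hb => ?_⟩
      obtain ⟨j, hj', rfl⟩ := List.mem_iff_getElem.1 hb
      simpa [List.getElem_append_left hj'] using hj ⟨j, by simp; omega⟩ hj'
  · rintro ⟨⟨hnd, h⟩, w, hw, hb⟩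
    refine ⟨List.nodup_append.2 ⟨hnd, List.nodup_singleton a, ?_⟩, ?_⟩
    · rintro b hbs c hc rfl
      exact hb b hbs (by simpa [List.mem_singleton.1 hc] using hw)
    · rintro ⟨i, hi⟩
      simp only [List.length_append, List.length_singleton] at hi
      rcases Nat.lt_succ_iff_lt_or_eq.1 hi with hi' | rfl
      · obtain ⟨w, hw, hj⟩ := h ⟨i, hi'⟩
        refine ⟨w, by simpa [List.getElem_append_left hi'] using hw, fun j hji => ?_⟩
        have hjs : (j : ℕ) < s.length := lt_trans hji hi'
        simpa [List.getElem_append_left hjs] using hj ⟨j, hjs⟩ hji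
      · refine ⟨w, by simpa using hw, fun j hji => ?_⟩
        simpa [List.getElem_append_left (show (j : ℕ) < s.length from hji)] using
          hb _ (List.getElem_mem (show (j : ℕ) < s.length from hji))

theorem bddAbove_length_isLegalSeq {V : Type*} [Fintype V] (G : SimpleGraph V) :
    BddAbove {n | ∃ s : List V, IsLegalSeq G s ∧ s.length = n} := by
  refine ⟨Fintype.card V, ?_⟩
  rintro _ ⟨s, hs, rfl⟩
  exact hs.1.length_le_card

theorem IsLegalSeq.length_le_grundyTotal {V : Type*} [Fintype V] {G : SimpleGraph V}
    {s : List V} (hs : IsLegalSeq G s) : s.length ≤ grundyTotal G :=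
  le_csSup (bddAbove_length_isLegalSeq G) ⟨s, hs, rfl⟩

theorem exists_isLegalSeq_length_eq_grundyTotal {V : Type*} [Fintype V] (G : SimpleGraph V) :
    ∃ s : List V, IsLegalSeq G s ∧ s.length = grundyTotal G :=
  Nat.sSup_mem (s := {n | ∃ s : List V, IsLegalSeq G s ∧ s.length = n})
    ⟨0, [], isLegalSeq_nil G, rfl⟩ (bddAbove_length_isLegalSeq G)

section SplitGraph

variable {V : Type*} {G : SimpleGraph V} {a b : V}

@[simp]
theorem splitGraphOf_adj_inl_inl : ¬ (splitGraphOf G).Adj (.inl a) (.inl b) := by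
  simp [splitGraphOf]

@[simp]
theorem splitGraphOf_adj_inl_inr : (splitGraphOf G).Adj (.inl a) (.inr b) ↔ G.Adj a b := by
  simp [splitGraphOf]

@[simp]
theorem splitGraphOf_adj_inr_inl : (splitGraphOf G).Adj (.inr a) (.inl b) ↔ G.Adj a b := by
  simp [splitGraphOf, G.adj_comm]

@[simp]
theorem splitGraphOf_adj_inr_inr : (splitGraphOf G).Adj (.inr a) (.inr b) ↔ a ≠ b := by
  simp [splitGraphOf]

theorem IsLegalSeq.map_inl {s : List V} (hs : IsLegalSeq G s) :
    IsLegalSeq (splitGraphOf G) (s.map .inl) := by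
  induction s using List.reverseRecOn with
  | nil => exact isLegalSeq_nil _
  | append_singleton s a ih =>
    obtain ⟨hs, w, hw, hb⟩ := isLegalSeq_append_singleton.1 hs
    rw [List.map_append, List.map_singleton, isLegalSeq_append_singleton]
    exact ⟨ih hs, .inr w, by simpa using hw, by simpa using hb⟩

theorem IsLegalSeq.map_inl_append_map_inr {s t : List V} (hs : IsLegalSeq G s)
    (ht : IsLegalSeq G t) : IsLegalSeq (splitGraphOf G) (s.map .inl ++ t.map .inr) := by
  induction t using List.reverseRecOn with
  | nil => simpa using hs.map_inl
  | append_singleton t a ih =>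
    obtain ⟨ht, w, hw, hb⟩ := isLegalSeq_append_singleton.1 ht
    rw [List.map_append, List.map_singleton, ← List.append_assoc, isLegalSeq_append_singleton]
    refine ⟨ih ht, .inl w, by simpa using hw, fun c hc => ?_⟩
    rcases List.mem_append.1 hc with hc | hc
    · obtain ⟨d, -, rfl⟩ := List.mem_map.1 hc
      simp
    · obtain ⟨d, hd, rfl⟩ := List.mem_map.1 hc
      simpa using hb d hd

/-- A legal sequence of the split graph has the total length of two legal sequences of `G`.
Either these are its traces on the two copies, or the sequence already dominates the whole
clique, so that it cannot be prolonged by a vertex of the stable set. -/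
theorem IsLegalSeq.exists_of_splitGraphOf (hiso : ∀ v : V, ∃ u : V, G.Adj v u)
    {s : List (V ⊕ V)} (hs : IsLegalSeq (splitGraphOf G) s) :
    ∃ A B : List V, IsLegalSeq G A ∧ IsLegalSeq G B ∧ A.length + B.length = s.length ∧
      (∀ b ∈ B, Sum.inr b ∈ s) ∧
      (((∀ a ∈ A, Sum.inl a ∈ s) ∧ ∀ b, Sum.inr b ∈ s → b ∈ B) ∨
        ∀ w, ∃ x ∈ s, (splitGraphOf G).Adj x (.inr w)) := by
  induction s using List.reverseRecOn with
  | nil => exact ⟨[], [], isLegalSeq_nil G, isLegalSeq_nil G, by simp⟩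
  | append_singleton s c ih =>
    obtain ⟨hs, w, hw, hc⟩ := isLegalSeq_append_singleton.1 hs
    obtain ⟨A, B, hA, hB, hlen, hBs, h⟩ := ih hs
    have prolong (b : V) (hcb : c = .inr b) (hb : IsLegalSeq G (B ++ [b])) :
        ∃ A B : List V, IsLegalSeq G A ∧ IsLegalSeq G B ∧
          A.length + B.length = (s ++ [c]).length ∧ (∀ b ∈ B, Sum.inr b ∈ s ++ [c]) ∧
          (((∀ a ∈ A, Sum.inl a ∈ s ++ [c]) ∧ ∀ b, Sum.inr b ∈ s ++ [c] → b ∈ B) ∨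
            ∀ w, ∃ x ∈ s ++ [c], (splitGraphOf G).Adj x (.inr w)) := by
      subst hcb
      refine ⟨A, B ++ [b], hA, hb, by simp; omega, by simp; grind, h.imp ?_ ?_⟩
      · rintro ⟨h₁, h₂⟩
        exact ⟨by simpa using h₁, by simp; grind⟩
      · intro h v
        obtain ⟨x, hx, hxv⟩ := h v
        exact ⟨x, by simp [hx], hxv⟩
    rcases c with a | b
    · rcases w with w | w
      · simp at hw
      rcases h with ⟨hAs, hsB⟩ | h
      · refine ⟨A ++ [a], B, isLegalSeq_append_singleton.2 ⟨hA, w, by simpa using hw, ?_⟩, hB,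
          by simp; omega, by simpa using hBs, .inl ⟨by simp; grind, by simpa using hsB⟩⟩
        exact fun x hx => by simpa using hc _ (hAs x hx)
      · obtain ⟨x, hx, hxw⟩ := h w
        exact absurd hxw (hc x hx)
    · rcases w with w | w
      · exact prolong b rfl (isLegalSeq_append_singleton.2
          ⟨hB, w, by simpa using hw, fun x hx => by simpa using hc _ (hBs x hx)⟩)
      rcases h with ⟨hAs, hsB⟩ | h
      · have hBw : ∀ x ∈ B, x = w := fun x hx => by simpa using hc _ (hBs x hx)
        by_cases hwB : w ∈ B
        · obtain ⟨x, hx⟩ := hiso w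
          refine ⟨A ++ [x], B, isLegalSeq_append_singleton.2 ⟨hA, w, hx.symm, ?_⟩, hB,
            by simp; omega, fun y hy => by simp [hBs y hy], .inr fun v => ?_⟩
          · exact fun y hy => by simpa using hc _ (hAs y hy)
          · by_cases hv : w = v
            · exact ⟨.inr b, by simp, hv ▸ hw⟩
            · exact ⟨.inr w, by simp [hBs w hwB], by simpa using hv⟩
        · obtain ⟨x, hx⟩ := hiso b
          exact prolong b rfl (isLegalSeq_append_singleton.2
            ⟨hB, x, hx, fun y hy => absurd (hBw y hy ▸ hy) hwB⟩)
      · obtain ⟨x, hx, hxw⟩ := h w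
        exact absurd hxw (hc x hx)

end SplitGraph

theorem grundyTotal_splitGraphOf {V : Type*} [Fintype V] (G : SimpleGraph V)
    (hiso : ∀ v : V, ∃ u : V, G.Adj v u) :
    grundyTotal (splitGraphOf G) = 2 * grundyTotal G := by
  apply le_antisymm
  · obtain ⟨s, hs, hlen⟩ := exists_isLegalSeq_length_eq_grundyTotal (splitGraphOf G)
    obtain ⟨A, B, hA, hB, hAB, -⟩ := hs.exists_of_splitGraphOf hiso
    have := hA.length_le_grundyTotal
    have := hB.length_le_grundyTotal
    omega
  · obtain ⟨s, hs, hlen⟩ := exists_isLegalSeq_length_eq_grundyTotal G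
    have := (hs.map_inl_append_map_inr hs).length_le_grundyTotal
    simp only [List.length_append, List.length_map] at this
    omega
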